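/- As $x \to \infty$, $\sum_{1 \le n \le x} \varrho(n) = \frac{2^{2/3}\sqrt{3}\,\Gamma(1/3)^3}{4\pi} x^{2/3} + 2^{3/2}\zeta(1/2)\sqrt{x} + O(x^{1/3})$, where $\zeta$ denotes the Riemann zeta function (analytically continued, so $\zeta(1/2)$ is its value at $1/2$). -/

import Mathlib

open Filter Asymptotics

/-- `varrho n` is the number of pairs `(j, k)` of positive integers with
`j * k * (j + k) / 2 = n`, i.e. with `j * k * (j + k) = 2 * n`. -/
noncomputable def varrho (n : ℕ) : ℕ :=
  Nat.card {p : ℕ × ℕ // 0 < p.1 ∧ 0 < p.2 ∧ p.1 * p.2 * (p.1 + p.2) = 2 * n}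


noncomputable def zT (n : ℕ) (s : ℂ) : ℂ :=
  ((n + 1 : ℝ) : ℂ) ^ (-s) - (((n + 2 : ℝ) : ℂ) ^ (1 - s) - ((n + 1 : ℝ) : ℂ) ^ (1 - s)) / (1 - s)

lemma zT_hasDeriv (r : ℂ) (t : ℝ) (ht : 0 < t) :
    HasDerivAt (fun y : ℝ => (y : ℂ) ^ r) (r * (t : ℂ) ^ (r - 1)) t := by
  have h := (hasDerivAt_id (t : ℂ)).cpow_const (c := r) (by left; simpa using ht)
  have h2 := h.comp_ofReal
  simpa using h2

lemma zT_bound (m : ℝ) (hm : 1 ≤ m) (s : ℂ) (hs : 1 / 4 < s.re) (hs2 : ‖s‖ < 10) (hs1 : s ≠ 1) :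
    ‖(m : ℂ) ^ (-s) - (((m + 1 : ℝ) : ℂ) ^ (1 - s) - (m : ℂ) ^ (1 - s)) / (1 - s)‖
      ≤ 10 * m ^ (-(5 / 4) : ℝ) := by
  have hm0 : 0 < m := by linarith
  have h1s : (1 - s) ≠ 0 := sub_ne_zero.mpr hs1.symm
  have key : ∀ t ∈ Set.Icc m (m + 1), ‖(t : ℂ) ^ (-s) - (m : ℂ) ^ (-s)‖ ≤ 10 * m ^ (-(5 / 4) : ℝ) := by
    intro t ht
    have hB : ∀ y ∈ Set.Icc m (m + 1), ‖(-s) * (y : ℂ) ^ (-s - 1)‖ ≤ 10 * m ^ (-(5 / 4) : ℝ) := by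
      intro y hy
      have hy0 : 0 < y := by linarith [hy.1]
      rw [norm_mul, norm_neg, Complex.norm_cpow_eq_rpow_re_of_pos hy0]
      have e1 : y ^ (-s - 1).re ≤ m ^ (-(5 / 4) : ℝ) := by
        calc y ^ (-s - 1).re ≤ y ^ (-(5 / 4) : ℝ) := by
              apply Real.rpow_le_rpow_of_exponent_le (by linarith [hy.1])
              simp; linarith
          _ ≤ m ^ (-(5 / 4) : ℝ) := Real.rpow_le_rpow_of_nonpos hm0 hy.1 (by norm_num)
      exact mul_le_mul hs2.le e1 (by positivity) (by norm_num)
    have := (convex_Icc m (m+1)).norm_image_sub_le_of_norm_hasDerivWithin_le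
      (f := fun y : ℝ => (y : ℂ) ^ (-s)) (fun y hy => (zT_hasDeriv (-s) y (by linarith [hy.1])).hasDerivWithinAt)
      hB (Set.left_mem_Icc.mpr (by linarith)) ht
    refine this.trans ?_
    have : ‖t - m‖ ≤ 1 := by rw [Real.norm_eq_abs, abs_le]; constructor <;> linarith [ht.1, ht.2]
    exact mul_le_of_le_one_right (by positivity) this
  have hG : ∀ t ∈ Set.Icc m (m + 1), HasDerivWithinAt
      (fun y : ℝ => (y : ℂ) ^ (1 - s) / (1 - s) - (y : ℂ) * (m : ℂ) ^ (-s))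
      ((t : ℂ) ^ (-s) - (m : ℂ) ^ (-s)) (Set.Icc m (m + 1)) t := by
    intro t ht
    have h1 := (zT_hasDeriv (1 - s) t (by linarith [ht.1])).div_const (1 - s)
    have h2 := ((hasDerivAt_id (t : ℂ)).comp_ofReal).mul_const ((m : ℂ) ^ (-s))
    have h3 := h1.sub h2
    refine (h3.congr_deriv ?_).hasDerivWithinAt
    rw [mul_div_cancel_left₀ _ h1s]
    simp
  have := (convex_Icc m (m+1)).norm_image_sub_le_of_norm_hasDerivWithin_le hG key
    (Set.left_mem_Icc.mpr (by linarith)) (Set.right_mem_Icc.mpr (by linarith))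
  rw [norm_sub_rev] at this
  have e : ‖m + 1 - m‖ = 1 := by simp
  rw [e, mul_one] at this
  refine le_trans (le_of_eq ?_) this
  congr 1
  push_cast
  ring

lemma zT_bound' (n : ℕ) (s : ℂ) (hs : 1 / 4 < s.re) (hs2 : ‖s‖ < 10) (hs1 : s ≠ 1) :
    ‖zT n s‖ ≤ 10 * ((n + 1 : ℕ) : ℝ) ^ (-(5 / 4) : ℝ) := by
  have := zT_bound (n + 1) (by linarith [n.cast_nonneg (α := ℝ)]) s hs hs2 hs1
  rw [zT]
  have e : (n + 1 + 1 : ℝ) = n + 2 := by ring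
  rw [e] at this
  push_cast at this ⊢
  exact this

lemma zT_summable : Summable (fun n : ℕ => 10 * ((n + 1 : ℕ) : ℝ) ^ (-(5 / 4) : ℝ)) := by
  apply Summable.mul_left
  exact (summable_nat_add_iff 1).mpr (Real.summable_nat_rpow.mpr (by norm_num))

lemma zT_sum_of_lt (s : ℂ) (hs : 1 < s.re) (hs2 : ‖s‖ < 10) (hs1 : s ≠ 1) :
    HasSum (fun n => zT n s) (riemannZeta s + 1 / (1 - s)) := by
  have h1 : HasSum (fun n : ℕ => ((n + 1 : ℝ) : ℂ) ^ (-s)) (riemannZeta s) := by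
    rw [zeta_eq_tsum_one_div_nat_add_one_cpow hs]
    have hsum : Summable (fun n : ℕ => 1 / (n + 1 : ℂ) ^ s) := by
      have := (summable_nat_add_iff 1).mpr (Complex.summable_one_div_nat_cpow.mpr hs)
      simpa using this
    convert hsum.hasSum using 2 with n
    rw [Complex.cpow_neg]; push_cast; simp
  have h2 : HasSum (fun n : ℕ => ((n + 2 : ℝ) : ℂ) ^ (1 - s) - ((n + 1 : ℝ) : ℂ) ^ (1 - s)) (-1) := by
    have hsm : Summable (fun n : ℕ => ((n + 2 : ℝ) : ℂ) ^ (1 - s) - ((n + 1 : ℝ) : ℂ) ^ (1 - s)) := by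
      have hz : Summable (fun n => zT n s) :=
        Summable.of_norm_bounded zT_summable (fun n => zT_bound' n s (by linarith) hs2 hs1)
      have h1s : (1 - s) ≠ 0 := sub_ne_zero.mpr hs1.symm
      refine ((h1.summable.sub hz).mul_left (1 - s)).congr ?_
      intro n
      rw [zT]
      field_simp
      ring
    rw [hsm.hasSum_iff_tendsto_nat]
    have e : ∀ N : ℕ, ∑ n ∈ Finset.range N, (((n + 2 : ℝ) : ℂ) ^ (1 - s) - ((n + 1 : ℝ) : ℂ) ^ (1 - s))
        = ((N + 1 : ℝ) : ℂ) ^ (1 - s) - 1 := by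
      intro N
      have := Finset.sum_range_sub (fun n : ℕ => ((n + 1 : ℝ) : ℂ) ^ (1 - s)) N
      simp only [Nat.cast_zero, zero_add, Complex.ofReal_one, Complex.one_cpow] at this
      rw [← this]
      apply Finset.sum_congr rfl
      intro n _
      push_cast
      ring_nf
    simp_rw [e]
    have : Tendsto (fun N : ℕ => ((N + 1 : ℝ) : ℂ) ^ (1 - s)) atTop (nhds 0) := by
      rw [tendsto_zero_iff_norm_tendsto_zero]
      have e2 : ∀ N : ℕ, ‖((N + 1 : ℝ) : ℂ) ^ (1 - s)‖ = ((N : ℝ) + 1) ^ (-(s.re - 1)) := by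
        intro N
        rw [Complex.norm_cpow_eq_rpow_re_of_pos (by positivity)]
        simp
      simp_rw [e2]
      have := (tendsto_rpow_neg_atTop (y := s.re - 1) (by linarith)).comp
        (tendsto_atTop_add_const_right atTop (1 : ℝ) tendsto_natCast_atTop_atTop)
      exact this
    simpa using this.sub_const 1
  have h3 := h1.sub (h2.div_const (1 - s))
  have e : riemannZeta s + 1 / (1 - s) = riemannZeta s - (-1) / (1 - s) := by ring
  rw [e]
  exact h3

lemma zT_half : HasSum (fun n => zT n (1 / 2)) (riemannZeta (1 / 2) + 2) := by
  set U : Set ℂ := {s | 1 / 4 < s.re} ∩ (Metric.ball 0 10 ∩ {s | s.re - 3 / 4 < s.im}) with hU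
  have hne : ∀ s ∈ U, s ≠ 1 := by
    rintro s ⟨_, _, h⟩ rfl
    norm_num at h
  have hopen : IsOpen U := by
    refine (isOpen_lt continuous_const Complex.continuous_re).inter (Metric.isOpen_ball.inter
      (isOpen_lt (by fun_prop) Complex.continuous_im))
  have hconv : Convex ℝ U := by
    refine (convex_halfSpace_re_gt _).inter ((convex_ball _ _).inter ?_)
    have := convex_halfSpace_lt (𝕜 := ℝ) (f := fun s : ℂ => s.re - s.im)
      ⟨by intros; simp; ring, by intros; simp; ring⟩ (3/4)
    have e : {s : ℂ | s.re - 3 / 4 < s.im} = {w : ℂ | w.re - w.im < 3 / 4} := by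
      ext s
      simp only [Set.mem_ofPred_eq]
      constructor <;> intro h <;> linarith
    rw [e]
    exact this
  have hb : ∀ (n : ℕ) (s : ℂ), s ∈ U → ‖zT n s‖ ≤ 10 * ((n + 1 : ℕ) : ℝ) ^ (-(5 / 4) : ℝ) :=
    fun n s h => zT_bound' n s h.1 (by simpa using h.2.1) (hne s h)
  have hd : DifferentiableOn ℂ (fun s => ∑' n, zT n s) U := by
    refine Complex.differentiableOn_tsum_of_summable_norm zT_summable ?_ hopen hb
    intro n s hs
    have h1 : 1 - s ≠ 0 := sub_ne_zero.mpr (hne s hs).symm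
    have a1 : ((n + 1 : ℝ) : ℂ) ≠ 0 := by exact_mod_cast (by positivity : (n + 1 : ℝ) ≠ 0)
    have a2 : ((n + 2 : ℝ) : ℂ) ≠ 0 := by exact_mod_cast (by positivity : (n + 2 : ℝ) ≠ 0)
    apply DifferentiableAt.differentiableWithinAt
    unfold zT
    have d1 : DifferentiableAt ℂ (fun s : ℂ => 1 - s) s := by fun_prop
    exact (differentiableAt_id.neg.const_cpow (Or.inl a1)).sub
      (((d1.const_cpow (Or.inl a2)).sub (d1.const_cpow (Or.inl a1))).div d1 h1)
  have hd2 : DifferentiableOn ℂ (fun s => riemannZeta s + 1 / (1 - s)) U := by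
    intro s hs
    have h1 : 1 - s ≠ 0 := sub_ne_zero.mpr (hne s hs).symm
    apply DifferentiableAt.differentiableWithinAt
    have d1 : DifferentiableAt ℂ (fun s : ℂ => 1 - s) s := by fun_prop
    exact (differentiableAt_riemannZeta (hne s hs)).add ((differentiableAt_const _).div d1 h1)
  have hz0 : (⟨2, 2⟩ : ℂ) ∈ U := by
    refine ⟨by norm_num, ?_, by norm_num⟩
    have := Complex.norm_le_abs_re_add_abs_im (⟨2, 2⟩ : ℂ)
    norm_num at this ⊢
    linarith
  have hh : (1 / 2 : ℂ) ∈ U := by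
    refine ⟨by norm_num, by norm_num, by norm_num⟩
  have heq := (hd.analyticOnNhd hopen).eqOn_of_preconnected_of_eventuallyEq
    (hd2.analyticOnNhd hopen) hconv.isPreconnected hz0 (by
      have : {s : ℂ | 1 < s.re} ∈ nhds (⟨2, 2⟩ : ℂ) :=
        (isOpen_lt continuous_const Complex.continuous_re).mem_nhds (by norm_num)
      filter_upwards [this, hopen.mem_nhds hz0] with s hs hsU
      exact (zT_sum_of_lt s hs (by simpa using hsU.2.1) (by rintro rfl; simp at hs)).tsum_eq)
  have h := heq hh
  have hs : Summable (fun n => zT n (1 / 2)) :=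
    Summable.of_norm_bounded zT_summable (fun n => hb n _ hh)
  have := hs.hasSum
  simp only at h
  rw [h] at this
  convert this using 2
  norm_num

noncomputable def uS (N : ℕ) : ℝ := ∑ j ∈ Finset.range N, 1 / √(j + 1 : ℝ) - 2 * √(N + 1 : ℝ)

lemma zeta_half : ∃ Z : ℝ, (Z : ℂ) = riemannZeta (1 / 2) ∧
    ∀ N : ℕ, uS N ≤ Z ∧ Z ≤ uS N + 1 / √(N + 1 : ℝ) := by
  set τ : ℕ → ℝ := fun n => 1 / √(n + 1 : ℝ) - 2 * (√(n + 2 : ℝ) - √(n + 1 : ℝ)) with hτ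
  have e : ∀ n, zT n (1 / 2) = (τ n : ℂ) := by
    intro n
    rw [zT, hτ]
    have c1 : (1 - 1 / 2 : ℂ) = ((1 / 2 : ℝ) : ℂ) := by push_cast; norm_num
    have c2 : (-(1 / 2) : ℂ) = ((-(1 / 2) : ℝ) : ℂ) := by push_cast; norm_num
    rw [c1, c2, ← Complex.ofReal_cpow (by positivity), ← Complex.ofReal_cpow (by positivity),
      ← Complex.ofReal_cpow (by positivity), Real.rpow_neg (by positivity),
      ← Real.sqrt_eq_rpow, ← Real.sqrt_eq_rpow]
    push_cast
    ring
  have h := zT_half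
  simp_rw [e] at h
  have hre := Complex.hasSum_re h
  have him := Complex.hasSum_im h
  simp only [Complex.ofReal_re, Complex.ofReal_im] at hre him
  have him0 := him.unique hasSum_zero
  refine ⟨(riemannZeta (1 / 2)).re, ?_, ?_⟩
  · apply Complex.ext
    · simp
    · simp at him0 ⊢; exact him0.symm
  have es : ∀ N, ∑ n ∈ Finset.range N, τ n = uS N + 2 := by
    intro N
    induction N with
    | zero => simp [uS]
    | succ N ih =>
      rw [Finset.sum_range_succ, ih, uS, uS, Finset.sum_range_succ, hτ]
      push_cast
      have : (N + 1 + 1 : ℝ) = N + 2 := by ring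
      rw [this]; ring
  have ht : Tendsto uS atTop (nhds (riemannZeta (1 / 2)).re) := by
    have := hre.tendsto_sum_nat
    simp_rw [es] at this
    have h2 := this.sub_const 2
    simpa using h2
  have hτ0 : ∀ n, 0 ≤ τ n ∧ τ n ≤ 1 / √(n + 1 : ℝ) - 1 / √(n + 2 : ℝ) := by
    intro n
    simp only [hτ]
    have p1 : 0 < √(n + 1 : ℝ) := by positivity
    have p2 : 0 < √(n + 2 : ℝ) := by positivity
    have q1 := Real.sq_sqrt (by positivity : (0 : ℝ) ≤ n + 1)
    have q2 := Real.sq_sqrt (by positivity : (0 : ℝ) ≤ n + 2)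
    have le : √(n + 1 : ℝ) ≤ √(n + 2 : ℝ) := Real.sqrt_le_sqrt (by linarith)
    set a := √(n + 1 : ℝ)
    set b := √(n + 2 : ℝ)
    have hba : (b - a) = 1 / (a + b) := by field_simp; linarith
    rw [hba]
    constructor
    · have : 1 / (a + b) ≤ 1 / (2 * a) := one_div_le_one_div_of_le (by positivity) (by linarith)
      have e : 2 * (1 / (2 * a)) = 1 / a := by field_simp
      linarith
    · have : 1 / (2 * b) ≤ 1 / (a + b) := one_div_le_one_div_of_le (by positivity) (by linarith)
      have e : 2 * (1 / (2 * b)) = 1 / b := by field_simp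
      linarith
  have step : ∀ N, uS (N + 1) = uS N + τ N := by
    intro N
    have := es (N + 1)
    rw [Finset.sum_range_succ, es N] at this
    linarith
  intro N
  constructor
  · apply Monotone.ge_of_tendsto (monotone_nat_of_le_succ _) ht
    intro n; rw [step]; linarith [(hτ0 n).1]
  · have ht2 : Tendsto (fun N : ℕ => uS N + 1 / √(N + 1 : ℝ)) atTop (nhds (riemannZeta (1 / 2)).re) := by
      have : Tendsto (fun N : ℕ => 1 / √(N + 1 : ℝ)) atTop (nhds 0) := by
        have := (tendsto_inv_atTop_zero.comp Real.tendsto_sqrt_atTop).comp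
          (tendsto_atTop_add_const_right atTop (1 : ℝ) tendsto_natCast_atTop_atTop)
        simpa [Function.comp_def] using this
      simpa using ht.add this
    refine Antitone.le_of_tendsto (f := fun N : ℕ => uS N + 1 / √(N + 1 : ℝ)) (antitone_nat_of_succ_le ?_) ht2 N
    intro n
    have := (hτ0 n).2
    have e : ((n + 1 : ℕ) : ℝ) + 1 = n + 2 := by push_cast; ring
    rw [e, step]
    linarith

noncomputable def cb (y : ℝ) : ℝ := y ^ ((1 : ℝ) / 3)

lemma cb_pos {y : ℝ} (hy : 0 < y) : 0 < cb y := Real.rpow_pos_of_pos hy _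
lemma cb_cube {y : ℝ} (hy : 0 ≤ y) : cb y ^ 3 = y := by
  rw [cb, ← Real.rpow_natCast, ← Real.rpow_mul hy]; norm_num
lemma cb_deriv {y : ℝ} (hy : 0 < y) : HasDerivAt cb (1 / (3 * cb y ^ 2)) y := by
  have h := Real.hasDerivAt_rpow_const (x := y) (p := (1 : ℝ) / 3) (Or.inl hy.ne')
  refine h.congr_deriv ?_
  have : cb y ^ 2 = y ^ ((2 : ℝ) / 3) := by
    rw [cb, ← Real.rpow_natCast, ← Real.rpow_mul hy.le]; norm_num
  rw [this, show (1 : ℝ) / 3 - 1 = -(2 / 3) by norm_num, Real.rpow_neg hy.le]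
  field_simp
lemma cb_cont : Continuous cb := Real.continuous_rpow_const (by norm_num)
lemma cb_unique {y z : ℝ} (hz : 0 ≤ z) (h : z ^ 3 = y) : cb y = z := by
  have hy : 0 ≤ y := by rw [← h]; positivity
  have h2 := cb_cube hy
  exact pow_left_injective₀ (cb y) z (Real.rpow_nonneg hy _) hz (h2.trans h.symm)
where pow_left_injective₀ (a b : ℝ) (ha : 0 ≤ a) (hb : 0 ≤ b) (h : a ^ 3 = b ^ 3) : a = b :=
  (pow_left_inj₀ ha hb (by norm_num)).mp h

noncomputable def wB (p : ℝ) : ℝ := 1 / (cb p ^ 2 * cb (1 - p) ^ 2)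

lemma wB_eq {p : ℝ} (h0 : 0 < p) (h1 : p < 1) :
    (wB p : ℂ) = (p : ℂ) ^ (((1 / 3 : ℝ) : ℂ) - 1) * (1 - (p : ℂ)) ^ (((1 / 3 : ℝ) : ℂ) - 1) := by
  have e : ∀ y : ℝ, 0 < y → (y : ℂ) ^ (((1 / 3 : ℝ) : ℂ) - 1) = ((1 / cb y ^ 2 : ℝ) : ℂ) := by
    intro y hy
    have : cb y ^ 2 = y ^ ((2 : ℝ) / 3) := by
      rw [cb, ← Real.rpow_natCast, ← Real.rpow_mul hy.le]; norm_num
    rw [show ((1 / 3 : ℝ) : ℂ) - 1 = ((1 / 3 - 1 : ℝ) : ℂ) by push_cast; ring, ← Complex.ofReal_cpow hy.le, this,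
      show (1 : ℝ) / 3 - 1 = -(2 / 3) by norm_num, Real.rpow_neg hy.le]
    simp
  rw [e p h0, show (1 - (p : ℂ)) = ((1 - p : ℝ) : ℂ) by push_cast; ring, e (1 - p) (by linarith), wB]
  push_cast
  have := (cb_pos h0).ne'
  have := (cb_pos (show 0 < 1 - p by linarith)).ne'
  field_simp

lemma wB_int : IntervalIntegrable wB MeasureTheory.volume 0 1 := by
  have h := Complex.betaIntegral_convergent (u := ((1 / 3 : ℝ) : ℂ)) (v := ((1 / 3 : ℝ) : ℂ))
    (by rw [Complex.ofReal_re]; norm_num) (by rw [Complex.ofReal_re]; norm_num)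
  rw [intervalIntegrable_iff_integrableOn_Ioo_of_le (by norm_num)] at h ⊢
  have h2 := h.re
  refine h2.congr ?_
  filter_upwards [MeasureTheory.ae_restrict_mem measurableSet_Ioo] with p hp
  rw [← wB_eq hp.1 hp.2]
  simp

lemma wB_val : ∫ p in (0:ℝ)..1, wB p = Real.Gamma (1 / 3) ^ 3 * √3 / (2 * Real.pi) := by
  have h := Complex.betaIntegral_eq_Gamma_mul_div ((1 / 3 : ℝ) : ℂ) ((1 / 3 : ℝ) : ℂ)
    (by rw [Complex.ofReal_re]; norm_num) (by rw [Complex.ofReal_re]; norm_num)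
  have e : Complex.betaIntegral ((1 / 3 : ℝ) : ℂ) ((1 / 3 : ℝ) : ℂ) = ((∫ p in (0:ℝ)..1, wB p : ℝ) : ℂ) := by
    rw [Complex.betaIntegral, ← intervalIntegral.integral_ofReal,
      intervalIntegral.integral_of_le (by norm_num), intervalIntegral.integral_of_le (by norm_num),
      MeasureTheory.integral_Ioc_eq_integral_Ioo, MeasureTheory.integral_Ioc_eq_integral_Ioo]
    exact MeasureTheory.setIntegral_congr_fun measurableSet_Ioo (fun p hp => (wB_eq hp.1 hp.2).symm)
  rw [e, ← Complex.ofReal_add, Complex.Gamma_ofReal, Complex.Gamma_ofReal] at h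
  have h' : ∫ p in (0:ℝ)..1, wB p = Real.Gamma (1 / 3) * Real.Gamma (1 / 3) / Real.Gamma (1 / 3 + 1 / 3) := by
    exact_mod_cast h
  have h3 := Real.Gamma_mul_Gamma_one_sub (1 / 3)
  rw [show Real.pi * (1 / 3) = Real.pi / 3 by ring, Real.sin_pi_div_three] at h3
  rw [show (1 : ℝ) - 1 / 3 = 1 / 3 + 1 / 3 by norm_num] at h3
  have g1 : 0 < Real.Gamma (1 / 3) := Real.Gamma_pos_of_pos (by norm_num)
  have g2 : 0 < Real.Gamma (1 / 3 + 1 / 3) := Real.Gamma_pos_of_pos (by norm_num)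
  have p0 := Real.pi_pos
  have s3 : 0 < √(3:ℝ) := by positivity
  rw [h']
  set G := Real.Gamma (1 / 3)
  set K := Real.Gamma (1 / 3 + 1 / 3)
  field_simp at h3 ⊢
  linear_combination -h3

lemma wB_half : ∫ p in (0:ℝ)..(1/2), wB p = (∫ p in (0:ℝ)..1, wB p) / 2 := by
  have i1 : IntervalIntegrable wB MeasureTheory.volume 0 (1/2) :=
    wB_int.mono_set (by rw [Set.uIcc_of_le, Set.uIcc_of_le] <;> norm_num
                        apply Set.Icc_subset_Icc <;> norm_num)
  have i2 : IntervalIntegrable wB MeasureTheory.volume (1/2) 1 :=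
    wB_int.mono_set (by rw [Set.uIcc_of_le, Set.uIcc_of_le] <;> norm_num
                        apply Set.Icc_subset_Icc <;> norm_num)
  rw [← intervalIntegral.integral_add_adjacent_intervals i1 i2]
  have : ∫ p in (0:ℝ)..(1/2), wB p = ∫ p in (1/2:ℝ)..1, wB p := by
    have h := intervalIntegral.integral_comp_sub_left (a := 0) (b := 1/2) wB 1
    have e : ∀ p, wB (1 - p) = wB p := by
      intro p; rw [wB, wB]; congr 1; rw [mul_comm]; congr 2; ring_nf
    simp_rw [e] at h
    rw [h]; norm_num
  rw [← this]; ring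

lemma wB_ftc : IntervalIntegrable (fun p => (1 - 2 * p) / 3 * wB p) MeasureTheory.volume 0 (1/2) ∧
    ∫ p in (0:ℝ)..(1/2), (1 - 2 * p) / 3 * wB p = cb (1/2) ^ 2 := by
  have i1 : IntervalIntegrable wB MeasureTheory.volume 0 (1/2) :=
    wB_int.mono_set (by rw [Set.uIcc_of_le, Set.uIcc_of_le] <;> norm_num
                        apply Set.Icc_subset_Icc <;> norm_num)
  have i2 : IntervalIntegrable (fun p => (1 - 2 * p) / 3 * wB p) MeasureTheory.volume 0 (1/2) :=
    i1.continuousOn_mul (by fun_prop)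
  refine ⟨i2, ?_⟩
  have := intervalIntegral.integral_eq_sub_of_hasDerivAt_of_le (a := 0) (b := 1/2) (by norm_num)
    (f := fun p => cb p * cb (1 - p)) (f' := fun p => (1 - 2 * p) / 3 * wB p)
    (by have := cb_cont; fun_prop) ?_ i2
  · rw [this]
    have z : cb 0 = 0 := by simp [cb]
    norm_num [z]; ring
  · intro p hp
    have hp1 : 0 < 1 - p := by linarith [hp.2]
    have h1 := cb_deriv hp.1
    have h2 : HasDerivAt (fun p => cb (1 - p)) (1 / (3 * cb (1 - p) ^ 2) * (-1)) p :=
      (cb_deriv hp1).comp p ((hasDerivAt_id p).const_sub 1)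
    refine (h1.mul h2).congr_deriv ?_
    have e1 := cb_cube hp.1.le
    have e2 := cb_cube hp1.le
    have := (cb_pos hp.1).ne'
    have := (cb_pos hp1).ne'
    rw [wB]
    have : (1 - 2 * p) = cb (1 - p) ^ 3 - cb p ^ 3 := by rw [e1, e2]; ring
    rw [this]
    field_simp
    ring

noncomputable def phiS (s : ℝ) : ℝ := √(2 / s + s ^ 2 / 4) - s / 2

lemma phiS_eq {s v : ℝ} (hs : 0 < s) (hv : 0 < v) (h : s * v * (s + v) = 2) : phiS s = v := by
  have : 2 / s + s ^ 2 / 4 = (v + s / 2) ^ 2 := by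
    have h2 : 2 / s = v * (s + v) := by rw [div_eq_iff hs.ne']; linarith
    rw [h2]; ring
  rw [phiS, this, Real.sqrt_sq (by positivity)]; ring

lemma phiS_spec {s : ℝ} (hs : 0 < s) : 0 < phiS s ∧ s * phiS s * (s + phiS s) = 2 := by
  have h := Real.sq_sqrt (by positivity : 0 ≤ 2 / s + s ^ 2 / 4)
  have h2 : s / 2 < √(2 / s + s ^ 2 / 4) := by
    apply Real.lt_sqrt_of_sq_lt
    have : 0 < 2 / s := by positivity
    nlinarith
  refine ⟨by rw [phiS]; linarith, ?_⟩
  rw [phiS]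
  set r := √(2 / s + s ^ 2 / 4)
  have : s * (r ^ 2) = 2 + s ^ 3 / 4 := by rw [h]; field_simp
  linear_combination this

noncomputable def sg (p : ℝ) : ℝ := cb 2 * cb p ^ 2 / cb (1 - p)

lemma sg_pos {p : ℝ} (h0 : 0 < p) (h1 : p < 1) : 0 < sg p := by
  have := cb_pos h0
  have := cb_pos (show 0 < 1 - p by linarith)
  have := cb_pos (show (0:ℝ) < 2 by norm_num)
  unfold sg; positivity

lemma sg_cube {p : ℝ} (h0 : 0 < p) (h1 : p < 1) : sg p ^ 3 = 2 * p ^ 2 / (1 - p) := by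
  have e1 := cb_cube h0.le
  have e2 := cb_cube (show 0 ≤ 1 - p by linarith)
  have e3 := cb_cube (show (0:ℝ) ≤ 2 by norm_num)
  rw [sg, div_pow, mul_pow, e2, e3, ← pow_mul, mul_comm 2 3, pow_mul, e1]

lemma phiS_sg {p : ℝ} (h0 : 0 < p) (h1 : p < 1) : phiS (sg p) = sg p * (1 - p) / p := by
  have hs := sg_pos h0 h1
  have h1' : 0 < 1 - p := by linarith
  apply phiS_eq hs (by positivity)
  have : sg p * (sg p * (1 - p) / p) * (sg p + sg p * (1 - p) / p) = sg p ^ 3 * (1 - p) / p ^ 2 := by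
    field_simp; ring
  rw [this, sg_cube h0 h1]
  field_simp

lemma sg_deriv {p : ℝ} (h0 : 0 < p) (h1 : p < 1) :
    HasDerivAt sg (sg p * (2 - p) / (3 * p * (1 - p))) p := by
  have hp1 : 0 < 1 - p := by linarith
  have d1 := cb_deriv h0
  have d2 : HasDerivAt (fun p => cb (1 - p)) (1 / (3 * cb (1 - p) ^ 2) * (-1)) p :=
      (cb_deriv hp1).comp p ((hasDerivAt_id p).const_sub 1)
  have a1 := (cb_pos h0).ne'
  have a2 := (cb_pos hp1).ne'
  have d3 := ((d1.pow 2).const_mul (cb 2)).div d2 a2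
  refine (d3.congr_deriv ?_)
  have e1 := cb_cube h0.le
  have e2 := cb_cube hp1.le
  unfold sg
  simp only [Pi.pow_apply]
  have f1 : 3 * p * (1 - p) = 3 * cb p ^ 3 * cb (1 - p) ^ 3 := by rw [e1, e2]
  have f2 : 2 - p = 2 * cb (1 - p) ^ 3 + cb p ^ 3 := by rw [e1, e2]; ring
  rw [f1, f2]
  field_simp
  ring

lemma sg_image : sg '' Set.Ioo 0 (1/2) = Set.Ioo 0 1 := by
  ext s
  constructor
  · rintro ⟨p, ⟨h0, h1⟩, rfl⟩
    have hs := sg_pos h0 (by linarith)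
    refine ⟨hs, ?_⟩
    have h3 := sg_cube h0 (by linarith : p < 1)
    have hp1 : 0 < 1 - p := by linarith
    have : sg p ^ 3 < 1 := by
      rw [h3, div_lt_one hp1]; nlinarith
    by_contra hc
    push Not at hc
    have := one_le_pow₀ hc (n := 3)
    linarith
  · rintro ⟨h0, h1⟩
    obtain ⟨hv, he⟩ := phiS_spec h0
    set v := phiS s with hvdef
    have hsv : s < v := by
      by_contra hc
      push Not at hc
      have h2 : s * v * (s + v) ≤ s * s * (s + s) := by gcongr
      have h3 : s ^ 3 < 1 := pow_lt_one₀ h0.le h1 (by norm_num)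
      nlinarith
    have hp0 : 0 < s / (s + v) := by positivity
    have hp2 : s / (s + v) < 1 / 2 := by rw [div_lt_div_iff₀ (by positivity) (by norm_num)]; linarith
    refine ⟨s / (s + v), ⟨hp0, hp2⟩, ?_⟩
    have h3 := sg_cube hp0 (by linarith)
    have h4 := sg_pos hp0 (by linarith)
    have : 2 * (s / (s + v)) ^ 2 / (1 - s / (s + v)) = s ^ 3 := by
      rw [← he]
      have : 1 - s / (s + v) = v / (s + v) := by field_simp; ring
      rw [this]
      field_simp
    rw [this] at h3
    exact (pow_left_inj₀ h4.le h0.le (by norm_num)).mp h3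

lemma sg_inj : Set.InjOn sg (Set.Ioo 0 (1/2)) := by
  have key : ∀ p ∈ Set.Ioo (0:ℝ) (1/2), sg p / (sg p + phiS (sg p)) = p := by
    intro p hp
    rw [phiS_sg hp.1 (by linarith [hp.2])]
    have := sg_pos hp.1 (by linarith [hp.2])
    have := hp.1
    have e : sg p + sg p * (1 - p) / p = sg p / p := by field_simp; ring
    rw [e]; field_simp
  intro p hp q hq h
  rw [← key p hp, ← key q hq, h]

lemma phiS_integral : ∫ s in Set.Ioo (0:ℝ) 1, phiS s
    = 1 / 2 + cb 2 ^ 2 / 4 * (Real.Gamma (1 / 3) ^ 3 * √3 / (2 * Real.pi)) := by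
  rw [← sg_image, MeasureTheory.integral_image_eq_integral_abs_deriv_smul measurableSet_Ioo
    (fun p hp => (sg_deriv hp.1 (by linarith [hp.2])).hasDerivWithinAt) sg_inj]
  have e : ∀ p ∈ Set.Ioo (0:ℝ) (1/2), |sg p * (2 - p) / (3 * p * (1 - p))| • phiS (sg p)
      = cb 2 ^ 2 / 2 * (wB p + (1 - 2 * p) / 3 * wB p) := by
    intro p hp
    have h0 := hp.1
    have hp1 : 0 < 1 - p := by linarith [hp.2]
    have hp2 : 0 < 2 - p := by linarith [hp.2]
    have hs := sg_pos h0 (by linarith)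
    rw [phiS_sg h0 (by linarith), abs_of_pos (by positivity), smul_eq_mul]
    have a1 := (cb_pos h0).ne'
    have a2 := (cb_pos hp1).ne'
    have e1 := cb_cube h0.le
    have e2 := cb_cube hp1.le
    have : sg p * (2 - p) / (3 * p * (1 - p)) * (sg p * (1 - p) / p) = sg p ^ 2 * (2 - p) / (3 * p ^ 2) := by
      field_simp
    rw [this, sg, wB]
    have f : p ^ 2 = cb p ^ 6 := by rw [← e1]; ring_nf; rw [show cb p ^ 3 = p from e1]
    rw [f]
    field_simp
    ring
  rw [MeasureTheory.setIntegral_congr_fun measurableSet_Ioo e,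
    ← MeasureTheory.integral_Ioc_eq_integral_Ioo, ← intervalIntegral.integral_of_le (by norm_num),
    intervalIntegral.integral_const_mul, intervalIntegral.integral_add ?_ wB_ftc.1, wB_ftc.2, wB_half, wB_val]
  · have : cb 2 * cb (1/2) = 1 := by
      rw [cb, cb, ← Real.mul_rpow (by norm_num) (by norm_num)]; norm_num
    have e2 : cb 2 ^ 2 * cb (1/2) ^ 2 = 1 := by rw [← mul_pow, this]; norm_num
    linear_combination e2 / 2
  · exact wB_int.mono_set (by rw [Set.uIcc_of_le, Set.uIcc_of_le] <;> norm_num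
                              apply Set.Icc_subset_Icc <;> norm_num)

noncomputable def hS (s : ℝ) : ℝ := √(2 / s + s ^ 2 / 4) - √(2 / s)

lemma hS_mono : MonotoneOn hS (Set.Ici 0) := by
  have key : ∀ s, 0 ≤ s → 0 ≤ hS s := by
    intro s hs
    rw [hS]
    have : √(2 / s) ≤ √(2 / s + s ^ 2 / 4) := Real.sqrt_le_sqrt (by nlinarith)
    linarith
  intro s hs t ht hst
  rcases eq_or_lt_of_le (show 0 ≤ s from hs) with h | h
  · rw [← h]; simpa [hS] using key t ht
  have ht0 : 0 < t := lt_of_lt_of_le h hst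
  have form : ∀ s, 0 < s → hS s = (s ^ 2 / 4) / (√(2 / s + s ^ 2 / 4) + √(2 / s)) := by
    intro s hs
    have q1 := Real.sq_sqrt (by positivity : 0 ≤ 2 / s + s ^ 2 / 4)
    have q2 := Real.sq_sqrt (by positivity : 0 ≤ 2 / s)
    have : 0 < √(2 / s) := by positivity
    rw [hS, eq_div_iff (by positivity)]
    linear_combination q1 - q2
  -- sqrt (A + B) - sqrt A, monotone through an intermediate point
  have q1 := Real.sq_sqrt (by positivity : 0 ≤ 2 / s + s ^ 2 / 4)
  have q2 := Real.sq_sqrt (by positivity : 0 ≤ 2 / s)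
  have q3 := Real.sq_sqrt (by positivity : 0 ≤ 2 / t + s ^ 2 / 4)
  have q4 := Real.sq_sqrt (by positivity : 0 ≤ 2 / t)
  have hAB : 2 / t ≤ 2 / s := by gcongr
  have l1 : √(2 / t) ≤ √(2 / s) := Real.sqrt_le_sqrt hAB
  have l2 : √(2 / t + s ^ 2 / 4) ≤ √(2 / s + s ^ 2 / 4) := Real.sqrt_le_sqrt (by linarith)
  have l3 : √(2 / t + s ^ 2 / 4) ≤ √(2 / t + t ^ 2 / 4) := by
    apply Real.sqrt_le_sqrt; gcongr
  have p2 : 0 < √(2 / t) := by positivity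
  rw [form s h]
  have mid : (s ^ 2 / 4) / (√(2 / t + s ^ 2 / 4) + √(2 / t)) = √(2 / t + s ^ 2 / 4) - √(2 / t) := by
    rw [div_eq_iff (by positivity)]
    linear_combination q4 - q3
  calc (s ^ 2 / 4) / (√(2 / s + s ^ 2 / 4) + √(2 / s))
      ≤ (s ^ 2 / 4) / (√(2 / t + s ^ 2 / 4) + √(2 / t)) := by gcongr
    _ = _ := mid
    _ ≤ hS t := by rw [hS]; linarith

lemma hS_le {s : ℝ} (hs : 0 ≤ s) : hS s ≤ s / 2 := by
  rw [hS]
  have : √(2 / s + s ^ 2 / 4) ≤ √(2 / s) + s / 2 := by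
    apply Real.sqrt_le_iff.mpr
    refine ⟨by positivity, ?_⟩
    have q2 := Real.sq_sqrt (by positivity : 0 ≤ 2 / s)
    have : 0 ≤ √(2 / s) * s := by positivity
    nlinarith
  linarith

lemma hS_int (a b : ℝ) (ha : 0 ≤ a) (hb : 0 ≤ b) : IntervalIntegrable hS MeasureTheory.volume a b := by
  apply MonotoneOn.intervalIntegrable
  apply hS_mono.mono
  intro x hx
  exact le_trans (le_min ha hb) hx.1

lemma hS_integral : ∫ s in (0:ℝ)..1, hS s = 3 / 4 - 2 * √2 +
    cb 2 ^ 2 / 4 * (Real.Gamma (1 / 3) ^ 3 * √3 / (2 * Real.pi)) := by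
  have h := phiS_integral
  rw [← MeasureTheory.integral_Ioc_eq_integral_Ioo, ← intervalIntegral.integral_of_le (by norm_num)] at h
  have i1 : IntervalIntegrable (fun s : ℝ => √2 * s ^ (-(1/2) : ℝ)) MeasureTheory.volume 0 1 :=
    (intervalIntegral.intervalIntegrable_rpow' (by norm_num)).const_mul _
  have i2 : IntervalIntegrable (fun s : ℝ => s / 2) MeasureTheory.volume 0 1 :=
    (by fun_prop : Continuous (fun s : ℝ => s / 2)).intervalIntegrable _ _
  have e : ∫ s in (0:ℝ)..1, phiS s = ∫ s in (0:ℝ)..1, (hS s + √2 * s ^ (-(1/2) : ℝ) - s / 2) := by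
    rw [intervalIntegral.integral_of_le (by norm_num), intervalIntegral.integral_of_le (by norm_num)]
    apply MeasureTheory.setIntegral_congr_fun measurableSet_Ioc
    intro s hs
    have : √2 * s ^ (-(1/2) : ℝ) = √(2 / s) := by
      rw [Real.rpow_neg hs.1.le, ← Real.sqrt_eq_rpow, Real.sqrt_div (by norm_num)]; rfl
    simp only [phiS, hS, this]; ring
  rw [e, intervalIntegral.integral_sub ((hS_int 0 1 (by norm_num) (by norm_num)).add i1) i2,
    intervalIntegral.integral_add (hS_int 0 1 (by norm_num) (by norm_num)) i1,
    intervalIntegral.integral_const_mul, integral_rpow (by left; norm_num)] at h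
  norm_num at h
  linarith

def cS (N : ℕ) : Finset (ℕ × ℕ) :=
  (Finset.Icc 1 (2 * N) ×ˢ Finset.Icc 1 (2 * N)).filter (fun p => p.1 * p.2 * (p.1 + p.2) ≤ 2 * N)

lemma mem_cS {N : ℕ} {p : ℕ × ℕ} : p ∈ cS N ↔ 0 < p.1 ∧ 0 < p.2 ∧ p.1 * p.2 * (p.1 + p.2) ≤ 2 * N := by
  obtain ⟨j, k⟩ := p
  simp only [cS, Finset.mem_filter, Finset.mem_product, Finset.mem_Icc]
  constructor
  · rintro ⟨⟨h1, h2⟩, h3⟩; exact ⟨h1.1, h2.1, h3⟩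
  · rintro ⟨h1, h2, h3⟩
    have a1 : j ≤ j * k * (j + k) := by
      calc j = j * 1 * 1 := by ring
        _ ≤ j * k * (j + k) := by gcongr <;> omega
    have a2 : k ≤ j * k * (j + k) := by
      calc k = 1 * k * 1 := by ring
        _ ≤ j * k * (j + k) := by gcongr <;> omega
    exact ⟨⟨⟨h1, by omega⟩, ⟨h2, by omega⟩⟩, h3⟩

lemma even_jk (j k : ℕ) : 2 ∣ j * k * (j + k) := by
  rcases Nat.even_or_odd j with hj | hj <;> rcases Nat.even_or_odd k with hk | hk
  · exact ((hj.mul_right k).mul_right (j + k)).two_dvd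
  · exact ((hj.mul_right k).mul_right (j + k)).two_dvd
  · exact ((hk.mul_left j).mul_right (j + k)).two_dvd
  · exact ((hj.add_odd hk).mul_left (j * k)).two_dvd

lemma sum_varrho (N : ℕ) : ∑ n ∈ Finset.Icc 1 N, varrho n = (cS N).card := by
  rw [Finset.card_eq_sum_card_fiberwise (f := fun p : ℕ × ℕ => p.1 * p.2 * (p.1 + p.2) / 2)
    (t := Finset.Icc 1 N)]
  · apply Finset.sum_congr rfl
    intro n hn
    rw [Finset.mem_Icc] at hn
    rw [varrho, ← Nat.card_eq_card_toFinset' n N hn]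
  · intro p hp
    have hp' := mem_cS.mp (Finset.mem_coe.mp hp)
    obtain ⟨h1, h2, h3⟩ := hp'
    have hpos : 0 < p.1 * p.2 * (p.1 + p.2) := by positivity
    have := even_jk p.1 p.2
    simp only [Finset.coe_Icc, Set.mem_Icc]
    omega
where
  Nat.card_eq_card_toFinset' (n N : ℕ) (hn : 1 ≤ n ∧ n ≤ N) :
    Nat.card {p : ℕ × ℕ // 0 < p.1 ∧ 0 < p.2 ∧ p.1 * p.2 * (p.1 + p.2) = 2 * n}
     = ((cS N).filter (fun p : ℕ × ℕ => p.1 * p.2 * (p.1 + p.2) / 2 = n)).card := by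
    rw [← Nat.card_eq_finsetCard]
    apply Nat.card_congr
    apply Equiv.subtypeEquivRight
    intro p
    rw [Finset.mem_filter, mem_cS]
    have := even_jk p.1 p.2
    constructor
    · rintro ⟨h1, h2, h3⟩; exact ⟨⟨h1, h2, by omega⟩, by omega⟩
    · rintro ⟨⟨h1, h2, h3⟩, h4⟩; exact ⟨h1, h2, by omega⟩

noncomputable def fA (a : ℝ) (t : ℝ) : ℝ := a * phiS (t / a)

lemma fA_pos {a t : ℝ} (ha : 0 < a) (ht : 0 < t) : 0 < fA a t :=
  mul_pos ha (phiS_spec (div_pos ht ha)).1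

lemma fA_spec {a t : ℝ} (ha : 0 < a) (ht : 0 < t) : t * fA a t * (t + fA a t) = 2 * a ^ 3 := by
  have h := (phiS_spec (div_pos ht ha)).2
  rw [fA]
  set v := phiS (t / a)
  rw [← h]; field_simp

lemma fA_iff {a t k : ℝ} (ha : 0 < a) (ht : 0 < t) (hk : 0 ≤ k) :
    t * k * (t + k) ≤ 2 * a ^ 3 ↔ k ≤ fA a t := by
  rw [← fA_spec ha ht]
  have hf := fA_pos ha ht
  constructor
  · intro h
    by_contra hc
    push Not at hc
    have : t * fA a t * (t + fA a t) < t * k * (t + k) := by gcongr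
    linarith
  · intro h; gcongr

lemma mem_cS_real {a x : ℝ} (ha : 0 < a) (hx : x = a ^ 3) {p : ℕ × ℕ} :
    p ∈ cS ⌊x⌋₊ ↔ 0 < p.1 ∧ 0 < p.2 ∧ (p.1 : ℝ) * p.2 * (p.1 + p.2) ≤ 2 * a ^ 3 := by
  rw [mem_cS]
  obtain ⟨m, hm⟩ := even_jk p.1 p.2
  have e : (p.1 : ℝ) * p.2 * (p.1 + p.2) = 2 * m := by exact_mod_cast hm
  rw [hm, e, ← hx]
  have hx0 : 0 ≤ x := by rw [hx]; positivity
  have : 2 * m ≤ 2 * ⌊x⌋₊ ↔ (2 : ℝ) * m ≤ 2 * x := by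
    rw [mul_le_mul_iff_right₀ (by norm_num), Nat.le_floor_iff hx0, mul_le_mul_iff_right₀ (by norm_num)]
  rw [this]

lemma card_cS {a x : ℝ} (ha : 0 < a) (hx : x = a ^ 3) :
    (cS ⌊x⌋₊).card + ⌊a⌋₊ ^ 2 = 2 * ∑ j ∈ Finset.Icc 1 ⌊a⌋₊, ⌊fA a j⌋₊ := by
  set S := cS ⌊x⌋₊ with hS
  set A := ⌊a⌋₊ with hA
  have hmem : ∀ p : ℕ × ℕ, p ∈ S ↔ 0 < p.1 ∧ 0 < p.2 ∧ (p.1 : ℝ) * p.2 * (p.1 + p.2) ≤ 2 * a ^ 3 :=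
    fun p => mem_cS_real ha hx
  have hU : S = S.filter (fun p => p.1 ≤ A) ∪ S.filter (fun p => p.2 ≤ A) := by
    rw [← Finset.filter_or, eq_comm, Finset.filter_eq_self]
    intro p hp
    by_contra hc
    push Not at hc
    obtain ⟨h1, h2, h3⟩ := (hmem p).mp hp
    have c1 := (Nat.floor_lt ha.le).mp hc.1
    have c2 := (Nat.floor_lt ha.le).mp hc.2
    have : a * a * (a + a) < (p.1 : ℝ) * p.2 * (p.1 + p.2) := by gcongr
    nlinarith
  have hI : S.filter (fun p => p.1 ≤ A) ∩ S.filter (fun p => p.2 ≤ A) = Finset.Icc 1 A ×ˢ Finset.Icc 1 A := by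
    ext p
    simp only [Finset.mem_inter, Finset.mem_filter, Finset.mem_product, Finset.mem_Icc, hmem]
    constructor
    · rintro ⟨⟨⟨h1, h2, h3⟩, h4⟩, _, h5⟩
      exact ⟨⟨h1, h4⟩, ⟨h2, h5⟩⟩
    · rintro ⟨⟨h1, h4⟩, ⟨h2, h5⟩⟩
      have c1 := (Nat.le_floor_iff ha.le).mp h4
      have c2 := (Nat.le_floor_iff ha.le).mp h5
      have : (p.1 : ℝ) * p.2 * (p.1 + p.2) ≤ a * a * (a + a) := by gcongr
      have h : (p.1 : ℝ) * p.2 * (p.1 + p.2) ≤ 2 * a ^ 3 := by nlinarith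
      exact ⟨⟨⟨h1, h2, h⟩, h4⟩, ⟨h1, h2, h⟩, h5⟩
  have hsw : (S.filter (fun p => p.2 ≤ A)).card = (S.filter (fun p => p.1 ≤ A)).card := by
    apply Finset.card_bij (fun p _ => p.swap)
    · intro p hp
      simp only [Finset.mem_filter, hmem, Prod.fst_swap, Prod.snd_swap] at hp ⊢
      obtain ⟨⟨h1, h2, h3⟩, h4⟩ := hp
      exact ⟨⟨h2, h1, by linarith [mul_comm (p.1 : ℝ) p.2, show (p.2 : ℝ) * p.1 * (p.2 + p.1) = p.1 * p.2 * (p.1 + p.2) by ring]⟩, h4⟩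
    · intro p _ q _ h; exact Prod.swap_injective h
    · intro p hp
      refine ⟨p.swap, ?_, Prod.swap_swap p⟩
      simp only [Finset.mem_filter, hmem, Prod.fst_swap, Prod.snd_swap] at hp ⊢
      obtain ⟨⟨h1, h2, h3⟩, h4⟩ := hp
      exact ⟨⟨h2, h1, by linarith [show (p.2 : ℝ) * p.1 * (p.2 + p.1) = p.1 * p.2 * (p.1 + p.2) by ring]⟩, h4⟩
  have hP : (S.filter (fun p => p.1 ≤ A)).card = ∑ j ∈ Finset.Icc 1 A, ⌊fA a j⌋₊ := by
    rw [Finset.card_eq_sum_card_fiberwise (f := Prod.fst) (t := Finset.Icc 1 A)]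
    · apply Finset.sum_congr rfl
      intro j hj
      rw [Finset.mem_Icc] at hj
      have hj0 : (0 : ℝ) < j := by exact_mod_cast hj.1
      rw [← Nat.card_Icc_one ⌊fA a j⌋₊]
      symm
      apply Finset.card_bij (fun k _ => (j, k))
      · intro k hk
        rw [Finset.mem_Icc] at hk
        simp only [Finset.mem_filter, hmem]
        refine ⟨⟨⟨hj.1, hk.1, ?_⟩, hj.2⟩, trivial⟩
        exact (fA_iff ha hj0 (by positivity)).mpr ((Nat.le_floor_iff (fA_pos ha hj0).le).mp hk.2)
      · intro k _ l _ h; exact (Prod.mk.inj h).2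
      · rintro ⟨j', k⟩ hp
        simp only [Finset.mem_filter, hmem] at hp
        obtain ⟨⟨⟨h1, h2, h3⟩, h4⟩, rfl⟩ := hp
        refine ⟨k, ?_, rfl⟩
        rw [Finset.mem_Icc]
        exact ⟨h2, (Nat.le_floor_iff (fA_pos ha hj0).le).mpr ((fA_iff ha hj0 (by positivity)).mp h3)⟩
    · intro p hp
      have hp := Finset.mem_coe.mp hp
      simp only [Finset.mem_filter, hmem] at hp
      simp only [Finset.coe_Icc, Set.mem_Icc]
      exact ⟨hp.1.1, hp.2⟩
  have h := Finset.card_union_add_card_inter (S.filter (fun p => p.1 ≤ A)) (S.filter (fun p => p.2 ≤ A))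
  rw [← hU, hI, hsw, hP, Finset.card_product, Nat.card_Icc] at h
  simp only [Nat.add_sub_cancel] at h
  rw [pow_two, h]; ring
where Nat.card_Icc_one (n : ℕ) : (Finset.Icc 1 n).card = n := by simp

lemma fA_split {a t : ℝ} (ha : 0 < a) (ht : 0 < t) :
    fA a t = a * hS (t / a) + a * √2 * √a * (1 / √t) - t / 2 := by
  have h1 : √(2 / (t / a)) = √2 * √a * (1 / √t) := by
    rw [show 2 / (t / a) = 2 * a / t by field_simp, Real.sqrt_div (by positivity),
      Real.sqrt_mul (by norm_num)]; ring
  rw [fA, phiS, hS, h1]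
  field_simp
  ring

lemma sum_hS {a : ℝ} (ha : 1 ≤ a) :
    |∑ i ∈ Finset.range ⌊a⌋₊, hS (((i + 1 : ℕ) : ℝ) / a) - a * ∫ s in (0:ℝ)..1, hS s| ≤ 1 := by
  have ha0 : 0 < a := by linarith
  set A := ⌊a⌋₊ with hA
  have hA1 : (A : ℝ) ≤ a := Nat.floor_le ha0.le
  have hA2 : a < A + 1 := Nat.lt_floor_add_one a
  have hm : MonotoneOn (fun t => hS (t / a)) (Set.Ici 0) := by
    intro s hs t ht h
    have hs' : (0:ℝ) ≤ s := hs
    have ht' : (0:ℝ) ≤ t := ht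
    exact hS_mono (div_nonneg hs' ha0.le) (div_nonneg ht' ha0.le) (by gcongr)
  have h00 : hS 0 = 0 := by simp [hS]
  have hnn : ∀ t, 0 ≤ t → 0 ≤ hS (t / a) := by
    intro t ht
    have := hm (Set.mem_Ici.mpr le_rfl) (Set.mem_Ici.mpr ht) ht
    simpa [h00] using this
  have hI : ∫ t in (0:ℝ)..a, hS (t / a) = a * ∫ s in (0:ℝ)..1, hS s := by
    rw [intervalIntegral.integral_comp_div _ ha0.ne', zero_div, div_self ha0.ne', smul_eq_mul]
  rw [← hI]
  have ii : ∀ b : ℝ, 0 ≤ b → IntervalIntegrable (fun t => hS (t / a)) MeasureTheory.volume 0 b := by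
    intro b hb
    apply MonotoneOn.intervalIntegrable
    apply hm.mono
    intro x hx
    rw [Set.uIcc_of_le hb] at hx
    exact hx.1
  have mono : ∀ b c : ℝ, 0 ≤ b → b ≤ c → ∫ t in (0:ℝ)..b, hS (t / a) ≤ ∫ t in (0:ℝ)..c, hS (t / a) := by
    intro b c hb hbc
    apply intervalIntegral.integral_mono_interval le_rfl hb hbc _ (ii c (by linarith))
    filter_upwards [MeasureTheory.ae_restrict_mem measurableSet_Ioc] with t ht
    exact hnn t ht.1.le
  have up : ∫ t in (0:ℝ)..a, hS (t / a) ≤ ∑ i ∈ Finset.range A, hS (((i + 1 : ℕ) : ℝ) / a) + 1 := by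
    have h1 := mono a ((A + 1 : ℕ) : ℝ) ha0.le (by push_cast; linarith)
    have h2 := MonotoneOn.integral_le_sum (x₀ := 0) (a := A + 1) (hm.mono (fun x hx => hx.1))
    simp only [zero_add] at h2
    rw [Finset.sum_range_succ] at h2
    have h3 : hS (((A + 1 : ℕ) : ℝ) / a) ≤ 1 := by
      have := hS_le (s := ((A + 1 : ℕ) : ℝ) / a) (by positivity)
      have h4 : ((A + 1 : ℕ) : ℝ) / a ≤ 2 := by
        rw [div_le_iff₀ ha0]; push_cast; linarith
      linarith
    linarith
  have lo : ∑ i ∈ Finset.range A, hS (((i + 1 : ℕ) : ℝ) / a) - 1 ≤ ∫ t in (0:ℝ)..a, hS (t / a) := by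
    have h1 := mono (A : ℝ) a (by positivity) hA1
    have h2 := MonotoneOn.sum_le_integral (x₀ := 0) (a := A) (hm.mono (fun x hx => hx.1))
    simp only [zero_add] at h2
    have h5 := Finset.sum_range_succ (fun i : ℕ => hS ((i : ℝ) / a)) A
    rw [Finset.sum_range_succ'] at h5
    simp only [Nat.cast_zero, zero_div, h00] at h5
    have h3 : hS ((A : ℝ) / a) ≤ 1 := by
      have := hS_le (s := (A : ℝ) / a) (by positivity)
      have h4 : (A : ℝ) / a ≤ 2 := by
        rw [div_le_iff₀ ha0]; linarith
      linarith
    linarith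
  rw [abs_le]
  constructor <;> linarith

lemma main_bound {Z : ℝ} (hZ : ∀ N : ℕ, uS N ≤ Z ∧ Z ≤ uS N + 1 / √(N + 1 : ℝ)) {a x : ℝ} (ha : 1 ≤ a)
    (hx : x = a ^ 3) :
    |((cS ⌊x⌋₊).card : ℝ) - (2 * (a ^ 2 * (∫ s in (0:ℝ)..1, hS s) + 2 * √2 * a ^ 2 + √2 * √x * Z - a ^ 2 / 4) - a ^ 2)|
      ≤ 20 * a := by
  have ha0 : 0 < a := by linarith
  have hc := card_cS ha0 hx
  have hs := sum_hS ha
  set I := ∫ s in (0:ℝ)..1, hS s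
  set A := ⌊a⌋₊ with hA
  have hA1 : (A : ℝ) ≤ a := Nat.floor_le ha0.le
  have hA2 : a < A + 1 := Nat.lt_floor_add_one a
  have hA0 : (0:ℝ) ≤ A := by positivity
  have hc' : ((cS ⌊x⌋₊).card : ℝ) + (A : ℝ) ^ 2 = 2 * ∑ j ∈ Finset.Icc 1 A, (⌊fA a j⌋₊ : ℝ) := by
    exact_mod_cast hc
  -- remove floors
  have f1 : ∑ j ∈ Finset.Icc 1 A, (⌊fA a j⌋₊ : ℝ) ≤ ∑ j ∈ Finset.Icc 1 A, fA a j := by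
    apply Finset.sum_le_sum
    intro j hj
    have hj0 : (0:ℝ) < j := by exact_mod_cast (Finset.mem_Icc.mp hj).1
    exact Nat.floor_le (fA_pos ha0 hj0).le
  have f2 : ∑ j ∈ Finset.Icc 1 A, fA a j ≤ ∑ j ∈ Finset.Icc 1 A, (⌊fA a j⌋₊ : ℝ) + A := by
    have : ∑ j ∈ Finset.Icc 1 A, fA a j ≤ ∑ j ∈ Finset.Icc 1 A, ((⌊fA a j⌋₊ : ℝ) + 1) := by
      apply Finset.sum_le_sum
      intro j hj
      exact (Nat.lt_floor_add_one _).le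
    rw [Finset.sum_add_distrib] at this
    simpa using this
  have f3 : ∑ j ∈ Finset.Icc 1 A, fA a j = ∑ i ∈ Finset.range A, fA a ((i + 1 : ℕ) : ℝ) := by
    rw [Finset.range_eq_Ico, Finset.sum_Ico_add' (fun j : ℕ => fA a (j : ℝ)) 0 A 1]
    rfl
  have f4 : ∑ i ∈ Finset.range A, fA a ((i + 1 : ℕ) : ℝ)
      = a * ∑ i ∈ Finset.range A, hS (((i + 1 : ℕ) : ℝ) / a)
        + a * √2 * √a * ∑ i ∈ Finset.range A, 1 / √(i + 1 : ℝ) - (A : ℝ) * (A + 1) / 4 := by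
    have e : ∀ i ∈ Finset.range A, fA a ((i + 1 : ℕ) : ℝ) = a * hS (((i + 1 : ℕ) : ℝ) / a)
        + a * √2 * √a * (1 / √(i + 1 : ℝ)) - (i + 1 : ℝ) / 2 := by
      intro i _
      rw [fA_split ha0 (by positivity)]; push_cast; ring
    have g : ∀ n : ℕ, ∑ i ∈ Finset.range n, (i + 1 : ℝ) / 2 = (n : ℝ) * (n + 1) / 4 := by
      intro n
      induction n with
      | zero => simp
      | succ n ih => rw [Finset.sum_range_succ, ih]; push_cast; ring
    rw [Finset.sum_congr rfl e, Finset.sum_sub_distrib, Finset.sum_add_distrib, ← Finset.mul_sum,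
      ← Finset.mul_sum, g]
  obtain ⟨z1, z2⟩ := hZ A
  rw [uS] at z1 z2
  set H := ∑ i ∈ Finset.range A, hS (((i + 1 : ℕ) : ℝ) / a)
  set R := ∑ i ∈ Finset.range A, 1 / √(i + 1 : ℝ)
  set F := ∑ j ∈ Finset.Icc 1 A, fA a j
  set Fl := ∑ j ∈ Finset.Icc 1 A, (⌊fA a j⌋₊ : ℝ)
  have sa : 0 < √a := by positivity
  have sqa := Real.sq_sqrt ha0.le
  have sA : √a ≤ √(A + 1 : ℝ) := Real.sqrt_le_sqrt hA2.le
  have sqA := Real.sq_sqrt (by positivity : (0:ℝ) ≤ A + 1)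
  have r1 : √(A + 1 : ℝ) - √a ≤ 1 / (2 * √a) := by
    rw [le_div_iff₀ (by positivity)]
    nlinarith
  have r2 : 1 / √(A + 1 : ℝ) ≤ 1 / √a := one_div_le_one_div_of_le sa sA
  have r3 : 2 * (1 / (2 * √a)) = 1 / √a := by field_simp
  have r4 : |R - 2 * √a - Z| ≤ 1 / √a := by
    rw [abs_le]; constructor <;> linarith
  have s2 : √2 ≤ (2:ℝ) := by
    rw [Real.sqrt_le_left (by norm_num)]; norm_num
  have s20 : 0 ≤ √(2:ℝ) := by positivity
  have r5 : |a * √2 * √a * R - 2 * √2 * a ^ 2 - √2 * √x * Z| ≤ 2 * a := by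
    have hsx : √x = a * √a := by
      rw [hx, show a ^ 3 = a ^ 2 * a by ring, Real.sqrt_mul (by positivity), Real.sqrt_sq ha0.le]
    have e : a * √2 * √a * R - 2 * √2 * a ^ 2 - √2 * √x * Z = a * √2 * √a * (R - 2 * √a - Z) := by
      rw [hsx]; linear_combination (2 * a * √2) * sqa
    rw [e, abs_mul, abs_of_nonneg (by positivity)]
    calc a * √2 * √a * |R - 2 * √a - Z| ≤ a * √2 * √a * (1 / √a) := by gcongr
      _ = a * √2 := by field_simp
      _ ≤ 2 * a := by nlinarith
  have r6 : |a * H - a ^ 2 * I| ≤ a := by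
    have e : a * H - a ^ 2 * I = a * (H - a * I) := by ring
    rw [e, abs_mul, abs_of_pos ha0]
    nlinarith
  have hF : F = _ := f3.trans f4
  have b1 : (A : ℝ) ^ 2 ≤ a ^ 2 := by gcongr
  have b2 : a ^ 2 - (A : ℝ) ^ 2 ≤ 2 * a := by nlinarith
  rw [abs_le] at r5 r6 ⊢
  obtain ⟨r51, r52⟩ := r5
  obtain ⟨r61, r62⟩ := r6
  clear_value H R F Fl I A
  clear hs hc f3 f4 hA z1 z2 sA sqA r1 r2 r3 r4 sqa hZ
  constructor <;> linarith

theorem summatory_varrho_asymptotic :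
    (fun x : ℝ =>
        ((∑ n ∈ Finset.Icc 1 ⌊x⌋₊, (varrho n : ℝ)) : ℂ)
          - ((((2 : ℝ) ^ ((2 : ℝ) / 3) * Real.sqrt 3 * (Real.Gamma (1 / 3)) ^ 3
                / (4 * Real.pi) * x ^ ((2 : ℝ) / 3) : ℝ) : ℂ)
              + ((2 : ℂ) ^ ((3 : ℂ) / 2) * riemannZeta (1 / 2) * (Real.sqrt x : ℂ))))
      =O[atTop] fun x : ℝ => x ^ ((1 : ℝ) / 3) := by
  obtain ⟨Z, hZ1, hZ2⟩ := zeta_half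
  apply IsBigO.of_bound 20
  filter_upwards [eventually_ge_atTop 1] with x hx
  have hx0 : 0 ≤ x := by linarith
  have ha : 1 ≤ cb x := Real.one_le_rpow hx (by norm_num)
  have hb := main_bound hZ2 ha (cb_cube hx0).symm
  have sq : ∀ y : ℝ, 0 ≤ y → y ^ ((2 : ℝ) / 3) = cb y ^ 2 := by
    intro y hy
    rw [cb, ← Real.rpow_natCast, ← Real.rpow_mul hy]; norm_num
  have h2 : (2 : ℂ) ^ ((3 : ℂ) / 2) = ((2 * √2 : ℝ) : ℂ) := by
    have e : (2 : ℝ) ^ ((3 : ℝ) / 2) = 2 * √2 := by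
      rw [show (3 : ℝ) / 2 = 1 + 1 / 2 by norm_num, Real.rpow_add (by norm_num), Real.rpow_one,
        Real.sqrt_eq_rpow]
    rw [← e, Complex.ofReal_cpow (by norm_num)]
    push_cast; rfl
  have hsum : (∑ n ∈ Finset.Icc 1 ⌊x⌋₊, ((varrho n : ℝ) : ℂ)) = (((cS ⌊x⌋₊).card : ℝ) : ℂ) := by
    rw [← sum_varrho]; push_cast; rfl
  rw [hsum, ← hZ1, h2, ← Complex.ofReal_mul, ← Complex.ofReal_mul, ← Complex.ofReal_add,
    ← Complex.ofReal_sub, Complex.norm_real, Real.norm_eq_abs, Real.norm_eq_abs, sq x hx0,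
    sq 2 (by norm_num)]
  have hr : |x ^ ((1 : ℝ) / 3)| = cb x := abs_of_nonneg (by positivity)
  rw [hr]
  refine le_trans (le_of_eq ?_) hb
  congr 2
  rw [hS_integral]
  have := Real.pi_pos.ne'
  field_simp
  ring
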